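/- Let λ and μ be two elements of C and let w ∈ W be such that μ − w(λ) ∈ L. Then there exist z ∈ 𝒜_L and w° ∈ W°(λ) such that w = z·w°. Moreover, for every positive integer d such that d·λ ∈ Q∨ and d·μ ∈ Q∨, one has z^d = 1. -/

import Mathlib

open Module

/-- A reduced, irreducible, crystallographic root system `Φ` inside the dual of a
`ℚ`-vector space `V`: each root `α` has a coroot `α∨ ∈ V` with `⟨α, α∨⟩ = 2`, pairings
between roots and coroots are integers, the dual reflections permute the roots, the
system is reduced, the roots span `V*`, and the system is irreducible. -/
structure RootSystemData (V : Type*) [AddCommGroup V] [Module ℚ V] where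
  Φ : Set (Module.Dual ℚ V)
  coroot : Module.Dual ℚ V → V
  finite : Φ.Finite
  span_eq_top : Submodule.span ℚ Φ = ⊤
  pairing_self : ∀ α ∈ Φ, α (coroot α) = 2
  pairing_int : ∀ α ∈ Φ, ∀ β ∈ Φ, ∃ n : ℤ, (n : ℚ) = β (coroot α)
  reduced : ∀ α ∈ Φ, ∀ c : ℚ, c • α ∈ Φ → c = 1 ∨ c = -1
  dual_refl_mem : ∀ α ∈ Φ, ∀ β ∈ Φ, β - β (coroot α) • α ∈ Φ
  irreducible : ∀ s : Set (Module.Dual ℚ V), s ⊆ Φ → s.Nonempty →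
      (∀ α ∈ s, ∀ β ∈ Φ, β ∉ s → β (coroot α) = 0) → s = Φ

variable {V : Type*} [AddCommGroup V] [Module ℚ V]

/-- The reflections `s_α : v ↦ v - ⟨α, v⟩ α∨` attached to the elements `α` of `S`. -/
def reflSet (R : RootSystemData V) (S : Set (Module.Dual ℚ V)) : Set (V ≃ₗ[ℚ] V) :=
  {w | ∃ α ∈ S, ∀ v, w v = v - α v • R.coroot α}

/-- The subgroup of `GL(V)` generated by the reflections `s_α`, `α ∈ S`. -/
def weylOf (R : RootSystemData V) (S : Set (Module.Dual ℚ V)) : Subgroup (V ≃ₗ[ℚ] V) :=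
  Subgroup.closure (reflSet R S)

/-- The Weyl group `W` of the root system. -/
def weyl (R : RootSystemData V) : Subgroup (V ≃ₗ[ℚ] V) :=
  weylOf R R.Φ

/-- The contragredient action of `w ∈ GL(V)` on the dual space: `β ↦ β ∘ w⁻¹`. -/
def dact (w : V ≃ₗ[ℚ] V) (β : Module.Dual ℚ V) : Module.Dual ℚ V :=
  β.comp (w.symm.toLinearMap)

/-- The coroot lattice `Q∨`. -/
def corootLattice (R : RootSystemData V) : AddSubgroup V :=
  AddSubgroup.closure (R.coroot '' R.Φ)

/-- The coweight lattice `P∨ = {v ∈ V | ⟨α, v⟩ ∈ ℤ for all α ∈ Φ}`, as a set. -/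
def coweightSet (R : RootSystemData V) : Set V :=
  {v | ∀ α ∈ R.Φ, ∃ n : ℤ, (n : ℚ) = α v}

/-- `m_α`: equal to `-1` on `α₀ = -α̃` and `0` elsewhere (in particular on `Δ`). -/
noncomputable def mfun (αt α : Module.Dual ℚ V) : ℚ := by
  classical exact if α = -αt then -1 else 0

/-- The extended (affine) base `Δ̃ = Δ ∪ {-α̃}`. -/
def extBase (Δ : Finset (Module.Dual ℚ V)) (αt : Module.Dual ℚ V) :
    Set (Module.Dual ℚ V) :=
  insert (-αt) (Δ : Set (Module.Dual ℚ V))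

/-- The closed fundamental alcove `C = {λ ∈ V | ⟨α, λ⟩ ≥ m_α for all α ∈ Δ̃}`. -/
def alcove (Δ : Finset (Module.Dual ℚ V)) (αt : Module.Dual ℚ V) : Set V :=
  {x | ∀ α ∈ extBase Δ αt, mfun αt α ≤ α x}

/-- `Φ(λ) = {α ∈ Φ | ⟨α, λ⟩ ∈ ℤ}`. -/
def PhiOf (R : RootSystemData V) (x : V) : Set (Module.Dual ℚ V) :=
  {α | α ∈ R.Φ ∧ ∃ k : ℤ, (k : ℚ) = α x}

/-- `I_λ = {α ∈ Δ̃ | ⟨α, λ⟩ = m_α}` for `λ ∈ C`. -/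
def IOf (Δ : Finset (Module.Dual ℚ V)) (αt : Module.Dual ℚ V) (x : V) :
    Set (Module.Dual ℚ V) :=
  {α | α ∈ extBase Δ αt ∧ α x = mfun αt α}

/-- `W°(λ)`: the subgroup of `W` generated by the reflections `s_α`, `α ∈ Φ(λ)`. -/
def Wcirc (R : RootSystemData V) (x : V) : Subgroup (V ≃ₗ[ℚ] V) :=
  weylOf R (PhiOf R x)

/-- `𝒜 = {z ∈ W | z(Δ̃) = Δ̃}`: automorphisms of the affine Dynkin diagram induced by `W`. -/
def AutTilde (R : RootSystemData V) (Δ : Finset (Module.Dual ℚ V))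
    (αt : Module.Dual ℚ V) : Set (V ≃ₗ[ℚ] V) :=
  {z | z ∈ weyl R ∧ dact z '' extBase Δ αt = extBase Δ αt}

/-- `𝒜_L = {z ∈ 𝒜 | ϖ∨(z) ∈ L}`, where `ϖ∨(z)` is the unique `v` with `z(C) + v = C`. -/
def AutTildeL (R : RootSystemData V) (Δ : Finset (Module.Dual ℚ V))
    (αt : Module.Dual ℚ V) (L : AddSubgroup V) : Set (V ≃ₗ[ℚ] V) :=
  {z | z ∈ AutTilde R Δ αt ∧
    ∃ v ∈ L, (fun x => z x + v) '' alcove Δ αt = alcove Δ αt}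

/-- The submodule of vectors of `V` fixed by every element of `S`. -/
def fixedSub (S : Set (V ≃ₗ[ℚ] V)) : Submodule ℚ V where
  carrier := {v | ∀ w ∈ S, w v = v}
  add_mem' := by
    intro a b ha hb w hw
    rw [map_add, ha w hw, hb w hw]
  zero_mem' := by
    intro w hw
    exact map_zero w
  smul_mem' := by
    intro c v hv w hw
    rw [map_smul, hv w hw]

/-- The set of orbits of a subgroup `A ≤ GL(V)` acting (contragrediently) on a set `S`
of linear forms. -/
def orbitsOn (A : Subgroup (V ≃ₗ[ℚ] V)) (S : Set (Module.Dual ℚ V)) :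
    Set (Set (Module.Dual ℚ V)) :=
  {O | ∃ α ∈ S, O = {β | ∃ z ∈ A, dact z α = β}}

/-- `λ_Ω = (1/(n_Ω·|Ω|))·Σ_{α∈Ω} ϖ_α∨` (written with `n_α` in place of the constant value
`n_Ω` of `n` on `Ω`). -/
noncomputable def lamOf (n : Module.Dual ℚ V → ℕ) (ϖ : Module.Dual ℚ V → V)
    (Ω : Set (Module.Dual ℚ V)) : V :=
  ∑ᶠ α ∈ Ω, ((n α : ℚ) * (Ω.ncard : ℚ))⁻¹ • ϖ α

/-- `λ` is quasi-isolated with respect to `L` if the only vector fixed by every element of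
`W_L(λ) = {w ∈ W | w(λ) - λ ∈ L}` is `0`. -/
def IsQuasiIsolated (R : RootSystemData V) (L : AddSubgroup V) (x : V) : Prop :=
  fixedSub {w : V ≃ₗ[ℚ] V | w ∈ weyl R ∧ w x - x ∈ L} = ⊥

/-- `𝒬_L`: the set of nonempty subsets `Ω ⊆ Δ̃` whose stabilizer in `𝒜_L` acts
transitively on `Ω`. -/
def QSetOf (R : RootSystemData V) (Δ : Finset (Module.Dual ℚ V))
    (αt : Module.Dual ℚ V) (L : AddSubgroup V) : Set (Set (Module.Dual ℚ V)) :=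
  {Ω | Ω ⊆ extBase Δ αt ∧ Ω.Nonempty ∧
    ∀ α ∈ Ω, ∀ β ∈ Ω, ∃ z ∈ AutTildeL R Δ αt L, dact z '' Ω = Ω ∧ dact z α = β}


section WeylGroup

variable {R : RootSystemData V}

lemma reflSet_mono {S T : Set (Module.Dual ℚ V)} (h : S ⊆ T) : reflSet R S ⊆ reflSet R T :=
  fun _ ⟨α, hα, hw⟩ => ⟨α, h hα, hw⟩

lemma weylOf_mono {S T : Set (Module.Dual ℚ V)} (h : S ⊆ T) : weylOf R S ≤ weylOf R T :=
  Subgroup.closure_mono (reflSet_mono h)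

lemma RootSystemData.neg_mem {α : Module.Dual ℚ V} (hα : α ∈ R.Φ) : -α ∈ R.Φ := by
  have h := R.dual_refl_mem α hα α hα
  rw [R.pairing_self α hα] at h
  convert h using 1
  module

lemma RootSystemData.root_ne_zero {α : Module.Dual ℚ V} (hα : α ∈ R.Φ) : α ≠ 0 := by
  rintro rfl
  simpa using R.pairing_self _ hα

lemma mul_self_of_mem_reflSet {s : V ≃ₗ[ℚ] V} (hs : s ∈ reflSet R R.Φ) : s * s = 1 := by
  obtain ⟨α, hα, hs⟩ := hs
  ext v
  have h2 := R.pairing_self α hα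
  simp only [LinearEquiv.mul_apply, LinearEquiv.coe_one, id, hs, map_sub, map_smul, h2, smul_eq_mul]
  module

lemma inv_eq_self_of_mem_reflSet {s : V ≃ₗ[ℚ] V} (hs : s ∈ reflSet R R.Φ) : s⁻¹ = s :=
  inv_eq_of_mul_eq_one_left (mul_self_of_mem_reflSet hs)

lemma exists_reflection {α : Module.Dual ℚ V} (hα : α ∈ R.Φ) :
    ∃ s : V ≃ₗ[ℚ] V, ∀ v, s v = v - α v • R.coroot α :=
  ⟨Module.reflection (R.pairing_self α hα), fun _ => Module.reflection_apply _ _⟩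

/-- Elements of the Weyl group permute the roots. -/
lemma comp_mem_of_mem_weyl {w : V ≃ₗ[ℚ] V} (hw : w ∈ weyl R) :
    ∀ β ∈ R.Φ, β ∘ₗ (w : V →ₗ[ℚ] V) ∈ R.Φ := by
  have key : ∀ s ∈ reflSet R R.Φ, ∀ β ∈ R.Φ, β ∘ₗ (s : V →ₗ[ℚ] V) ∈ R.Φ := by
    rintro s ⟨α, hα, hs⟩ β hβ
    convert R.dual_refl_mem α hα β hβ using 1
    ext v
    simp [hs, mul_comm]
  induction hw using Subgroup.closure_induction'' with
  | mem s hs => exact key s hs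
  | inv_mem s hs => rw [inv_eq_self_of_mem_reflSet hs]; exact key s hs
  | one => exact fun β hβ => hβ
  | mul a b _ _ ha hb => exact fun β hβ => hb _ (ha β hβ)

lemma eq_zero_of_forall_root_eq_zero {v : V} (h : ∀ α ∈ R.Φ, α v = 0) : v = 0 := by
  refine (Module.forall_dual_apply_eq_zero_iff ℚ v).1 fun f => ?_
  have hf : f ∈ Submodule.span ℚ R.Φ := R.span_eq_top ▸ Submodule.mem_top
  induction hf using Submodule.span_induction with
  | mem α hα => exact h α hα
  | zero => simp
  | add a b _ _ ha hb => simp [ha, hb]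
  | smul c a _ ha => simp [ha]

lemma eq_of_forall_root_eq {u v : V} (h : ∀ α ∈ R.Φ, α u = α v) : u = v :=
  sub_eq_zero.1 <| eq_zero_of_forall_root_eq_zero (R := R) fun α hα => by
    rw [map_sub, h α hα, sub_self]

lemma finite_weyl : (weyl R : Set (V ≃ₗ[ℚ] V)).Finite := by
  have := R.finite.to_subtype
  let F : weyl R → (R.Φ → R.Φ) := fun w β => ⟨_, comp_mem_of_mem_weyl w.2 β.1 β.2⟩
  have hF : Function.Injective F := by
    intro a b hab
    ext v
    refine eq_of_forall_root_eq (R := R) fun α hα => ?_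
    exact LinearMap.congr_fun (congrArg Subtype.val (congrFun hab ⟨α, hα⟩)) v
  exact Set.finite_coe_iff.1 (Finite.of_injective F hF)

/-- The canonical Weyl-invariant symmetric form on `V`. -/
noncomputable def rootForm (R : RootSystemData V) (u v : V) : ℚ :=
  ∑ α ∈ R.finite.toFinset, α u * α v

lemma rootForm_comm (u v : V) : rootForm R u v = rootForm R v u :=
  Finset.sum_congr rfl fun _ _ => mul_comm _ _

lemma rootForm_sub_smul (u v u' : V) (c : ℚ) :
    rootForm R (u - c • v) u' = rootForm R u u' - c * rootForm R v u' := by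
  simp only [rootForm, Finset.mul_sum, ← Finset.sum_sub_distrib, map_sub, map_smul, smul_eq_mul]
  exact Finset.sum_congr rfl fun _ _ => by ring

lemma rootForm_self_nonneg (v : V) : 0 ≤ rootForm R v v :=
  Finset.sum_nonneg fun _ _ => mul_self_nonneg _

lemma rootForm_self_pos {v : V} (hv : v ≠ 0) : 0 < rootForm R v v := by
  refine (rootForm_self_nonneg v).lt_of_ne fun h => hv ?_
  refine eq_zero_of_forall_root_eq_zero (R := R) fun α hα => ?_
  have := (Finset.sum_eq_zero_iff_of_nonneg fun α _ => mul_self_nonneg (α v)).1 h.symm α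
    (R.finite.mem_toFinset.2 hα)
  simpa using this

lemma rootForm_map {w : V ≃ₗ[ℚ] V} (hw : w ∈ weyl R) (u v : V) :
    rootForm R (w u) (w v) = rootForm R u v := by
  refine Finset.sum_nbij' (fun β => β ∘ₗ (w : V →ₗ[ℚ] V))
    (fun β => β ∘ₗ ((w⁻¹ : V ≃ₗ[ℚ] V) : V →ₗ[ℚ] V)) ?_ ?_ ?_ ?_ ?_
  · simpa using comp_mem_of_mem_weyl hw
  · simpa using comp_mem_of_mem_weyl (inv_mem hw)
  · intro β _; ext v; exact congrArg β (w.apply_symm_apply v)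
  · intro β _; ext v; exact congrArg β (w.symm_apply_apply v)
  · intro β _; rfl

lemma coroot_ne_zero {α : Module.Dual ℚ V} (hα : α ∈ R.Φ) : R.coroot α ≠ 0 := by
  intro h
  simpa [h] using R.pairing_self α hα

lemma two_mul_rootForm_coroot {α : Module.Dual ℚ V} (hα : α ∈ R.Φ) (v : V) :
    2 * rootForm R (R.coroot α) v = α v * rootForm R (R.coroot α) (R.coroot α) := by
  obtain ⟨s, hs⟩ := exists_reflection hα
  have hsW : s ∈ weyl R := Subgroup.subset_closure ⟨α, hα, hs⟩
  have h := rootForm_map hsW v (R.coroot α)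
  have h1 : s (R.coroot α) = (0 : V) - (1 : ℚ) • R.coroot α := by
    rw [hs, R.pairing_self α hα]; module
  have h0 : rootForm R 0 (s v) = 0 := by simp [rootForm]
  rw [rootForm_comm, h1, rootForm_sub_smul, h0, rootForm_comm _ (s v), hs, rootForm_sub_smul,
    rootForm_comm v] at h
  linarith

lemma rootForm_coroot_pos {α : Module.Dual ℚ V} (hα : α ∈ R.Φ) {v : V} (hv : 0 < α v) :
    0 < rootForm R (R.coroot α) v := by
  have h1 := two_mul_rootForm_coroot hα v
  have h2 := mul_pos hv (rootForm_self_pos (R := R) (coroot_ne_zero hα))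
  linarith

lemma pairing_pos_symm {α β : Module.Dual ℚ V} (hα : α ∈ R.Φ) (hβ : β ∈ R.Φ)
    (h : 0 < α (R.coroot β)) : 0 < β (R.coroot α) := by
  have h1 := rootForm_coroot_pos hα h
  rw [rootForm_comm] at h1
  have h2 := two_mul_rootForm_coroot hβ (R.coroot α)
  have h3 := rootForm_self_pos (R := R) (coroot_ne_zero hβ)
  by_contra! h4
  nlinarith [mul_nonneg_of_nonpos_of_nonpos h4 (neg_nonpos.2 h3.le)]

/-- A coroot is determined by its pairing with the root and the invariant form. -/
lemma eq_coroot {α : Module.Dual ℚ V} (hα : α ∈ R.Φ) {c : V} (h2 : α c = 2)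
    (hc : ∀ v, 2 * rootForm R c v = α v * rootForm R c c) : c = R.coroot α := by
  set b := rootForm R (R.coroot α) (R.coroot α) with hb
  have hb0 : 0 < b := rootForm_self_pos (coroot_ne_zero hα)
  have h1 := hc (R.coroot α)
  have h3 := two_mul_rootForm_coroot hα c
  rw [R.pairing_self α hα] at h1
  rw [h2, rootForm_comm] at h3
  have hcb : rootForm R c c = b := by linarith
  have hkey : ∀ v, rootForm R (c - (1 : ℚ) • R.coroot α) v = 0 := by
    intro v
    have h4 := hc v
    have h5 := two_mul_rootForm_coroot hα v
    rw [hcb] at h4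
    rw [rootForm_sub_smul]
    linarith
  by_contra hne
  have : c - (1 : ℚ) • R.coroot α ≠ 0 := by rwa [one_smul, sub_ne_zero]
  exact (rootForm_self_pos this).ne' (hkey _)

lemma coroot_neg {α : Module.Dual ℚ V} (hα : α ∈ R.Φ) : R.coroot (-α) = -R.coroot α := by
  refine (eq_coroot (R.neg_mem hα) (by simp [R.pairing_self α hα]) fun v => ?_).symm
  have h := two_mul_rootForm_coroot hα v
  have e : ∀ u v : V, rootForm R (-u) v = - rootForm R u v := fun u v => by simp [rootForm]
  rw [e, e, rootForm_comm _ (-_), e, LinearMap.neg_apply]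
  linarith

lemma map_coroot_comp {w : V ≃ₗ[ℚ] V} (hw : w ∈ weyl R) {α : Module.Dual ℚ V} (hα : α ∈ R.Φ) :
    w (R.coroot (α ∘ₗ (w : V →ₗ[ℚ] V))) = R.coroot α := by
  have hβ := comp_mem_of_mem_weyl hw α hα
  refine eq_coroot hα (R.pairing_self _ hβ) fun v => ?_
  have h := two_mul_rootForm_coroot hβ (w.symm v)
  rw [← rootForm_map hw, ← rootForm_map hw (R.coroot _) (R.coroot _)] at h
  simpa using h

/-- Conjugating a reflection by an element of the Weyl group. -/
lemma reflection_mul_eq {w s t : V ≃ₗ[ℚ] V} (hw : w ∈ weyl R) {α β : Module.Dual ℚ V}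
    (hα : α ∈ R.Φ) (hs : ∀ v, s v = v - α v • R.coroot α)
    (ht : ∀ v, t v = v - β v • R.coroot β) (hβ : α ∘ₗ (w : V →ₗ[ℚ] V) = β) :
    s * w = w * t := by
  subst hβ
  ext v
  simp [hs, ht, map_coroot_comp hw hα]

end WeylGroup

section Lattice

variable {R : RootSystemData V}

lemma coroot_mem_corootLattice {α : Module.Dual ℚ V} (hα : α ∈ R.Φ) :
    R.coroot α ∈ corootLattice R :=
  AddSubgroup.subset_closure ⟨α, hα, rfl⟩

lemma int_smul_coroot_mem {α : Module.Dual ℚ V} (hα : α ∈ R.Φ) {c : ℚ}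
    (hc : ∃ n : ℤ, (n : ℚ) = c) : c • R.coroot α ∈ corootLattice R := by
  obtain ⟨n, rfl⟩ := hc
  rw [Int.cast_smul_eq_zsmul]
  exact zsmul_mem (coroot_mem_corootLattice hα) n

lemma add_mem_coweightSet {u v : V} (hu : u ∈ coweightSet R) (hv : v ∈ coweightSet R) :
    u + v ∈ coweightSet R := fun α hα => by
  obtain ⟨m, hm⟩ := hu α hα
  obtain ⟨n, hn⟩ := hv α hα
  exact ⟨m + n, by simp [hm, hn]⟩

lemma neg_mem_coweightSet {v : V} (hv : v ∈ coweightSet R) : -v ∈ coweightSet R :=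
  fun α hα => by
    obtain ⟨m, hm⟩ := hv α hα
    exact ⟨-m, by simp [hm]⟩

lemma nsmul_mem_coweightSet {v : V} (hv : v ∈ coweightSet R) (n : ℕ) :
    n • v ∈ coweightSet R :=
  fun α hα => by
    obtain ⟨m, hm⟩ := hv α hα
    exact ⟨n * m, by simp [hm]⟩

lemma map_mem_coweightSet {w : V ≃ₗ[ℚ] V} (hw : w ∈ weyl R) {v : V} (hv : v ∈ coweightSet R) :
    w v ∈ coweightSet R :=
  fun α hα => hv _ (comp_mem_of_mem_weyl hw α hα)

lemma corootLattice_subset_coweightSet : (corootLattice R : Set V) ⊆ coweightSet R := by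
  intro v hv
  induction hv using AddSubgroup.closure_induction with
  | mem v hv =>
    obtain ⟨β, hβ, rfl⟩ := hv
    exact fun α hα => R.pairing_int β hβ α hα
  | zero => exact fun α _ => ⟨0, by simp⟩
  | add a b _ _ ha hb => exact add_mem_coweightSet ha hb
  | neg a _ ha => exact neg_mem_coweightSet ha

/-- `W°(x)` moves `x` only by elements of the coroot lattice. -/
lemma sub_mem_corootLattice_of_mem_Wcirc {x : V} {u : V ≃ₗ[ℚ] V} (hu : u ∈ Wcirc R x) :
    u x - x ∈ corootLattice R := by
  have hsub : reflSet R (PhiOf R x) ⊆ reflSet R R.Φ := reflSet_mono fun _ h => h.1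
  have step : ∀ s ∈ reflSet R (PhiOf R x), ∀ u : V ≃ₗ[ℚ] V, u x - x ∈ corootLattice R →
      (s * u) x - x ∈ corootLattice R := by
    rintro s ⟨α, hα, hs⟩ u ih
    have h1 : α (u x) • R.coroot α ∈ corootLattice R := by
      refine int_smul_coroot_mem hα.1 ?_
      obtain ⟨m, hm⟩ := hα.2
      obtain ⟨n, hn⟩ := corootLattice_subset_coweightSet ih α hα.1
      exact ⟨n + m, by rw [Int.cast_add, hn, hm, map_sub, sub_add_cancel]⟩
    convert sub_mem ih h1 using 1
    rw [LinearEquiv.mul_apply, hs]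
    abel
  induction hu using Subgroup.closure_induction_left with
  | one => simp
  | mul_left s hs u _ ih => exact step s hs u ih
  | inv_mul_cancel s hs u _ ih =>
    rw [inv_eq_self_of_mem_reflSet (hsub hs)]
    exact step s hs u ih

/-- The Weyl group acts trivially on the coweight lattice modulo the coroot lattice. -/
lemma map_sub_self_mem_corootLattice {w : V ≃ₗ[ℚ] V} (hw : w ∈ weyl R) {v : V}
    (hv : v ∈ coweightSet R) : w v - v ∈ corootLattice R := by
  have h : PhiOf R v = R.Φ := Set.ext fun α => ⟨fun h => h.1, fun h => ⟨h, hv α h⟩⟩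
  exact sub_mem_corootLattice_of_mem_Wcirc (R := R) (x := v) (by rwa [Wcirc, h])

lemma map_mem_corootLattice {w : V ≃ₗ[ℚ] V} (hw : w ∈ weyl R) {v : V}
    (hv : v ∈ corootLattice R) : w v ∈ corootLattice R := by
  simpa using add_mem (map_sub_self_mem_corootLattice hw (corootLattice_subset_coweightSet hv)) hv

/-- An element of the coroot lattice all of whose pairings with roots have absolute value at
most `1` vanishes. -/
lemma eq_zero_of_mem_corootLattice_of_abs_le_one {v : V} (hv : v ∈ corootLattice R)
    (h : ∀ α ∈ R.Φ, |α v| ≤ 1) : v = 0 := by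
  have hv' : v ∈ AddSubmonoid.closure (R.coroot '' R.Φ) := by
    have hneg : -(R.coroot '' R.Φ) = R.coroot '' R.Φ := by
      apply Set.Subset.antisymm
      · rintro _ ⟨α, hα, h⟩
        exact ⟨-α, R.neg_mem hα, by rw [coroot_neg hα, h, neg_neg]⟩
      · rintro _ ⟨α, hα, rfl⟩
        exact ⟨-α, R.neg_mem hα, coroot_neg hα⟩
    have : v ∈ (corootLattice R).toAddSubmonoid := hv
    rwa [corootLattice, AddSubgroup.closure_toAddSubmonoid, hneg, Set.union_self] at this
  obtain ⟨l, hl, rfl⟩ := AddSubmonoid.exists_list_of_mem_closure hv'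
  clear hv hv'
  obtain ⟨n, hn⟩ : ∃ n, l.length = n := ⟨_, rfl⟩
  induction n generalizing l with
  | zero => simp [List.length_eq_zero_iff.1 hn]
  | succ n ih =>
    set v := l.sum with hv
    by_contra hne
    obtain ⟨β, hβ, hβl, hpos⟩ : ∃ β ∈ R.Φ, R.coroot β ∈ l ∧ 0 < rootForm R (R.coroot β) v := by
      by_contra! hle
      have hsum : ∀ m : List V, (∀ b ∈ m, rootForm R b v ≤ 0) → rootForm R m.sum v ≤ 0 := by
        intro m hm
        induction m with
        | nil => simp [rootForm]
        | cons b m ih =>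
          have e : rootForm R (b + m.sum) v = rootForm R b v + rootForm R m.sum v := by
            simp [rootForm, add_mul, Finset.sum_add_distrib]
          rw [List.sum_cons, e]
          exact add_nonpos (hm b (by simp)) (ih fun c hc => hm c (by simp [hc]))
      refine (hsum l fun b hb => ?_).not_gt (rootForm_self_pos hne)
      obtain ⟨β, hβ, rfl⟩ := hl b hb
      exact hle β hβ hb
    have hβv : β v = 1 := by
      have h1 := two_mul_rootForm_coroot hβ v
      have h2 := rootForm_self_pos (R := R) (coroot_ne_zero hβ)
      have h3 : 0 < β v := by
        by_contra! h4
        nlinarith [mul_nonneg_of_nonpos_of_nonpos h4 (neg_nonpos.2 h2.le)]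
      obtain ⟨k, hk⟩ : ∃ k : ℤ, (k : ℚ) = β v := by
        refine corootLattice_subset_coweightSet ?_ β hβ
        exact list_sum_mem fun b hb => AddSubgroup.subset_closure (hl b hb)
      have h5 := (abs_le.1 (h β hβ)).2
      rw [← hk] at h3 h5 ⊢
      norm_cast at h3 h5 ⊢
      omega
    classical
    obtain ⟨s, hs⟩ := exists_reflection hβ
    have hsW : s ∈ weyl R := Subgroup.subset_closure ⟨β, hβ, hs⟩
    have hsv : (l.erase (R.coroot β)).sum = s v := by
      rw [hs, hβv, one_smul, hv, ← List.sum_erase hβl, add_sub_cancel_left]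
    have h0 := ih (l.erase (R.coroot β)) (fun b hb => hl b (List.mem_of_mem_erase hb))
      (fun α hα => by
        rw [hsv]
        exact h (α ∘ₗ (s : V →ₗ[ℚ] V)) (comp_mem_of_mem_weyl hsW α hα))
      (by rw [List.length_erase_of_mem hβl, hn, Nat.add_sub_cancel])
    rw [hsv] at h0
    exact hne (by simpa using h0)

end Lattice

/-- `ϖ` is the family of fundamental coweights of the base `Δ` of `R`, whose highest root is
`αt`. -/
structure IsFundamentalCoweights (R : RootSystemData V) (Δ : Finset (Module.Dual ℚ V))
    (αt : Module.Dual ℚ V) (ϖ : Module.Dual ℚ V → V) : Prop where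
  subset : (Δ : Set (Module.Dual ℚ V)) ⊆ R.Φ
  apply_self : ∀ α ∈ Δ, α (ϖ α) = 1
  apply_of_ne : ∀ α ∈ Δ, ∀ β ∈ Δ, α ≠ β → α (ϖ β) = 0
  eq_sum : ∀ f : Module.Dual ℚ V, f = ∑ α ∈ Δ, f (ϖ α) • α
  nonneg_or_nonpos : ∀ β ∈ R.Φ, (∀ α ∈ Δ, 0 ≤ β (ϖ α)) ∨ (∀ α ∈ Δ, β (ϖ α) ≤ 0)
  highest_mem : αt ∈ R.Φ
  le_highest : ∀ β ∈ R.Φ, ∀ α ∈ Δ, β (ϖ α) ≤ αt (ϖ α)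

lemma exists_fundamentalCoweights [FiniteDimensional ℚ V] (R : RootSystemData V)
    (Δ : Finset (Module.Dual ℚ V))
    (hΔΦ : (Δ : Set (Module.Dual ℚ V)) ⊆ R.Φ)
    (hΔind : LinearIndependent ℚ
      (fun x : (Δ : Set (Module.Dual ℚ V)) => (x : Module.Dual ℚ V)))
    (hΔbase : ∀ α ∈ R.Φ, ∃ c : Module.Dual ℚ V →₀ ℤ,
        (c.support : Set (Module.Dual ℚ V)) ⊆ (Δ : Set (Module.Dual ℚ V)) ∧
        α = c.sum (fun β k => (k : ℚ) • β) ∧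
        ((∀ β, 0 ≤ c β) ∨ (∀ β, c β ≤ 0)))
    (αt : Module.Dual ℚ V) (hαtΦ : αt ∈ R.Φ)
    (hhigh : ∀ γ ∈ R.Φ, ∃ c : Module.Dual ℚ V →₀ ℚ,
        (c.support : Set (Module.Dual ℚ V)) ⊆ (Δ : Set (Module.Dual ℚ V)) ∧
        αt - γ = c.sum (fun β k => k • β) ∧ (∀ β, 0 ≤ c β)) :
    ∃ ϖ, IsFundamentalCoweights R Δ αt ϖ := by
  classical
  have hspan : (⊤ : Submodule ℚ (Module.Dual ℚ V)) ≤ Submodule.span ℚ (Set.range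
      (fun x : (Δ : Set (Module.Dual ℚ V)) => (x : Module.Dual ℚ V))) := by
    rw [← R.span_eq_top, Submodule.span_le, Subtype.range_coe]
    intro α hα
    obtain ⟨c, hc, rfl, -⟩ := hΔbase α hα
    exact Submodule.sum_mem _ fun β hβ =>
      Submodule.smul_mem _ _ (Submodule.subset_span (hc hβ))
  let b := Basis.mk hΔind hspan
  have hb : ∀ i, b i = i := fun i => by simp [b]
  let ϖ : Module.Dual ℚ V → V := fun α =>
    if h : α ∈ Δ then (Module.evalEquiv ℚ V).symm (b.coord ⟨α, h⟩) else 0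
  have hϖ : ∀ (f : Module.Dual ℚ V) α (h : α ∈ Δ), f (ϖ α) = b.repr f ⟨α, h⟩ := by
    intro f α h
    simp [ϖ, h, Module.apply_evalEquiv_symm_apply]
  have hself : ∀ α ∈ Δ, α (ϖ α) = 1 := by
    intro α h
    rw [hϖ α α h]
    have h1 := congrArg (fun g => g ⟨α, h⟩) (b.repr_self ⟨α, h⟩)
    simpa [hb] using h1
  have hne : ∀ α ∈ Δ, ∀ β ∈ Δ, α ≠ β → α (ϖ β) = 0 := by
    intro α hα β hβ hab
    rw [hϖ α β hβ, show α = b ⟨α, hα⟩ from (hb ⟨α, hα⟩).symm, b.repr_self,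
      Finsupp.single_eq_of_ne]
    simpa [hb, Subtype.ext_iff] using hab.symm
  have hcoef : ∀ c : Module.Dual ℚ V →₀ ℚ,
      (c.support : Set (Module.Dual ℚ V)) ⊆ (Δ : Set (Module.Dual ℚ V)) → ∀ α ∈ Δ,
      (c.sum fun β k => k • β) (ϖ α) = c α := by
    intro c hc α hα
    rw [Finsupp.sum, LinearMap.sum_apply, Finset.sum_eq_single α]
    · simp [hself α hα]
    · intro β hβ hβα
      simp [hne β (hc hβ) α hα hβα]
    · intro h
      simp [Finsupp.notMem_support_iff.1 h]
  have hcoefInt : ∀ c : Module.Dual ℚ V →₀ ℤ,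
      (c.support : Set (Module.Dual ℚ V)) ⊆ (Δ : Set (Module.Dual ℚ V)) → ∀ α ∈ Δ,
      (c.sum fun β k => (k : ℚ) • β) (ϖ α) = c α := by
    intro c hc α hα
    have h := hcoef (c.mapRange (Int.cast : ℤ → ℚ) Int.cast_zero)
      (fun β hβ => hc (Finsupp.support_mapRange hβ)) α hα
    rw [Finsupp.sum_mapRange_index (by simp)] at h
    simpa using h
  refine ⟨ϖ, hΔΦ, hself, hne, fun f => ?_, fun β hβ => ?_, hαtΦ,
    fun β hβ α hα => ?_⟩
  · conv_lhs => rw [← b.sum_repr f]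
    rw [← Finset.sum_coe_sort Δ]
    exact Finset.sum_congr rfl fun i _ => by rw [hϖ f i i.2, hb]
  · obtain ⟨c, hc, rfl, h | h⟩ := hΔbase β hβ
    · exact Or.inl fun α hα => by rw [hcoefInt c hc α hα]; exact_mod_cast h α
    · exact Or.inr fun α hα => by rw [hcoefInt c hc α hα]; exact_mod_cast h α
  · obtain ⟨c, hc, hsum, h⟩ := hhigh β hβ
    have h1 := hcoef c hc α hα
    rw [← hsum, LinearMap.sub_apply] at h1
    linarith [h α]

namespace IsFundamentalCoweights

variable {R : RootSystemData V} {Δ : Finset (Module.Dual ℚ V)} {αt : Module.Dual ℚ V}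
  {ϖ : Module.Dual ℚ V → V}

lemma apply_eq_sum (h : IsFundamentalCoweights R Δ αt ϖ) (f : Module.Dual ℚ V) (v : V) :
    f v = ∑ α ∈ Δ, f (ϖ α) * α v := by
  conv_lhs => rw [h.eq_sum f]
  simp

lemma eq_of_forall (h : IsFundamentalCoweights R Δ αt ϖ) {f g : Module.Dual ℚ V}
    (hfg : ∀ α ∈ Δ, f (ϖ α) = g (ϖ α)) : f = g := by
  rw [h.eq_sum f, h.eq_sum g]
  exact Finset.sum_congr rfl fun α hα => by rw [hfg α hα]

lemma apply_nonneg (h : IsFundamentalCoweights R Δ αt ϖ) {f : Module.Dual ℚ V} {v : V}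
    (hf : ∀ α ∈ Δ, 0 ≤ f (ϖ α)) (hv : ∀ α ∈ Δ, 0 ≤ α v) : 0 ≤ f v := by
  rw [h.apply_eq_sum]
  exact Finset.sum_nonneg fun α hα => mul_nonneg (hf α hα) (hv α hα)

lemma apply_pos (h : IsFundamentalCoweights R Δ αt ϖ) {f : Module.Dual ℚ V} {v : V}
    (hf : ∀ α ∈ Δ, 0 ≤ f (ϖ α)) (hf0 : f ≠ 0) (hv : ∀ α ∈ Δ, 0 < α v) : 0 < f v := by
  have hex : ∃ α ∈ Δ, 0 < f (ϖ α) := by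
    by_contra! hle
    exact hf0 (h.eq_of_forall fun α hα => le_antisymm (hle α hα) (hf α hα))
  rw [h.apply_eq_sum]
  obtain ⟨α, hα, hpos⟩ := hex
  exact Finset.sum_pos' (fun α hα => mul_nonneg (hf α hα) (hv α hα).le)
    ⟨α, hα, mul_pos hpos (hv α hα)⟩

lemma apply_le_highest (h : IsFundamentalCoweights R Δ αt ϖ) {β : Module.Dual ℚ V}
    (hβ : β ∈ R.Φ) {v : V} (hv : ∀ α ∈ Δ, 0 ≤ α v) : β v ≤ αt v := by
  have := h.apply_nonneg (f := αt - β) (v := v)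
    (fun α hα => by simpa using h.le_highest β hβ α hα) hv
  simpa using this

lemma eq_smul_of_forall_ne (h : IsFundamentalCoweights R Δ αt ϖ) {α : Module.Dual ℚ V} (hα : α ∈ Δ)
    (f : Module.Dual ℚ V) (hf : ∀ β ∈ Δ, β ≠ α → f (ϖ β) = 0) : f = f (ϖ α) • α := by
  conv_lhs => rw [h.eq_sum f]
  exact Finset.sum_eq_single_of_mem α hα fun β hβ hne => by rw [hf β hβ hne, zero_smul]

/-- A positive root proportional to a simple root is that simple root. -/
lemma eq_of_forall_ne (h : IsFundamentalCoweights R Δ αt ϖ) {α β : Module.Dual ℚ V} (hα : α ∈ Δ)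
    (hβ : β ∈ R.Φ) (hpos : ∀ γ ∈ Δ, 0 ≤ β (ϖ γ)) (hf : ∀ γ ∈ Δ, γ ≠ α → β (ϖ γ) = 0) :
    β = α := by
  have h1 := h.eq_smul_of_forall_ne hα β hf
  rcases R.reduced α (h.subset hα) (β (ϖ α)) (h1 ▸ hβ) with h2 | h2
  · rw [h1, h2, one_smul]
  · linarith [hpos α hα]

/-- A simple reflection permutes the positive roots other than its simple root. -/
lemma eq_of_reflection_nonpos (h : IsFundamentalCoweights R Δ αt ϖ) {α β : Module.Dual ℚ V}
    (hα : α ∈ Δ) (hβ : β ∈ R.Φ) (hpos : ∀ γ ∈ Δ, 0 ≤ β (ϖ γ))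
    (hneg : ∀ γ ∈ Δ, (β - β (R.coroot α) • α) (ϖ γ) ≤ 0) : β = α := by
  refine h.eq_of_forall_ne hα hβ hpos fun γ hγ hne => le_antisymm ?_ (hpos γ hγ)
  simpa [h.apply_of_ne α hα γ hγ hne.symm] using hneg γ hγ

/-- The Weyl group is generated by the simple reflections. -/
lemma weyl_le (h : IsFundamentalCoweights R Δ αt ϖ) : weyl R ≤ weylOf R Δ := by
  have key : ∀ n : ℕ, ∀ β ∈ R.Φ, (∀ γ ∈ Δ, 0 ≤ β (ϖ γ)) → ∑ γ ∈ Δ, β (ϖ γ) ≤ n →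
      ∀ s : V ≃ₗ[ℚ] V, (∀ v, s v = v - β v • R.coroot β) → s ∈ weylOf R Δ := by
    intro n
    induction n with
    | zero =>
      intro β hβ hpos hsum
      refine absurd (h.eq_of_forall (g := 0) fun γ hγ => ?_) (R.root_ne_zero hβ)
      have h1 := Finset.single_le_sum hpos hγ
      simpa using le_antisymm (h1.trans (by simpa using hsum)) (hpos γ hγ)
    | succ n ih =>
      intro β hβ hpos hsum s hs
      by_cases hβΔ : β ∈ Δ
      · exact Subgroup.subset_closure ⟨β, hβΔ, hs⟩
      obtain ⟨α, hα, hαβ⟩ : ∃ α ∈ Δ, 0 < α (R.coroot β) := by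
        by_contra! hle
        have h1 := h.apply_eq_sum β (R.coroot β)
        rw [R.pairing_self β hβ] at h1
        have h2 := Finset.sum_nonpos fun γ hγ =>
          mul_nonpos_of_nonneg_of_nonpos (hpos γ hγ) (hle γ hγ)
        linarith
      have hαΦ := h.subset hα
      have hk : 1 ≤ β (R.coroot α) := by
        have h1 := pairing_pos_symm hαΦ hβ hαβ
        obtain ⟨k, hk⟩ := R.pairing_int α hαΦ β hβ
        rw [← hk] at h1 ⊢
        exact_mod_cast h1
      have hγΦ := R.dual_refl_mem α hαΦ β hβ
      obtain ⟨t, ht⟩ := exists_reflection hαΦ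
      obtain ⟨r, hr⟩ := exists_reflection hγΦ
      have htΔ : t ∈ weylOf R Δ := Subgroup.subset_closure ⟨α, hα, ht⟩
      have htW : t ∈ weyl R := weylOf_mono h.subset htΔ
      have hrΔ : r ∈ weylOf R Δ := by
        refine ih _ hγΦ ?_ ?_ r hr
        · refine (h.nonneg_or_nonpos _ hγΦ).resolve_right fun hneg => hβΔ ?_
          rwa [h.eq_of_reflection_nonpos hα hβ hpos hneg]
        · have h1 : ∑ γ ∈ Δ, α (ϖ γ) = 1 := by
            rw [Finset.sum_eq_single_of_mem α hα fun γ hγ hne =>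
              h.apply_of_ne α hα γ hγ hne.symm, h.apply_self α hα]
          simp only [LinearMap.sub_apply, LinearMap.smul_apply, smul_eq_mul,
            Finset.sum_sub_distrib, ← Finset.mul_sum, h1]
          push_cast at hsum
          linarith
      have hst : s * t = t * r := by
        refine reflection_mul_eq htW hβ hs hr ?_
        ext v
        simp [ht, mul_comm]
      rw [eq_mul_inv_of_mul_eq hst]
      exact mul_mem (mul_mem htΔ hrΔ) (inv_mem htΔ)
  refine (Subgroup.closure_le _).2 ?_
  rintro s ⟨β, hβ, hs⟩
  rcases h.nonneg_or_nonpos β hβ with hpos | hneg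
  · obtain ⟨n, hn⟩ := exists_nat_ge (∑ γ ∈ Δ, β (ϖ γ))
    exact key n β hβ hpos hn s hs
  · obtain ⟨n, hn⟩ := exists_nat_ge (∑ γ ∈ Δ, (-β) (ϖ γ))
    refine key n (-β) (R.neg_mem hβ) (fun γ hγ => by simpa using hneg γ hγ) hn s fun v => ?_
    rw [hs, coroot_neg hβ, LinearMap.neg_apply, neg_smul_neg]

/-- An element of the Weyl group is a product of simple reflections. -/
lemma exists_list (h : IsFundamentalCoweights R Δ αt ϖ) {u : V ≃ₗ[ℚ] V} (hu : u ∈ weyl R) :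
    ∃ l : List (V ≃ₗ[ℚ] V), (∀ s ∈ l, s ∈ reflSet R Δ) ∧ l.prod = u := by
  have hu' : u ∈ (weylOf R Δ).toSubmonoid := h.weyl_le hu
  rw [weylOf, Subgroup.closure_toSubmonoid] at hu'
  obtain ⟨l, hl, rfl⟩ := Submonoid.exists_list_of_mem_closure hu'
  refine ⟨l, fun s hs => (hl s hs).elim id fun h1 => ?_, rfl⟩
  rw [Set.mem_inv] at h1
  rwa [← inv_eq_self_of_mem_reflSet (reflSet_mono h.subset h1), inv_inv] at h1

lemma list_prod_mem_weyl (h : IsFundamentalCoweights R Δ αt ϖ) {l : List (V ≃ₗ[ℚ] V)}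
    (hl : ∀ s ∈ l, s ∈ reflSet R Δ) : l.prod ∈ weyl R :=
  list_prod_mem fun s hs => Subgroup.subset_closure (reflSet_mono h.subset (hl s hs))

lemma apply_ne_zero (h : IsFundamentalCoweights R Δ αt ϖ) {p : V} (hp : ∀ α ∈ Δ, 0 < α p)
    {β : Module.Dual ℚ V} (hβ : β ∈ R.Φ) : β p ≠ 0 := by
  have h0 := R.root_ne_zero hβ
  rcases h.nonneg_or_nonpos β hβ with hpos | hneg
  · exact (h.apply_pos hpos h0 hp).ne'
  · have h1 := h.apply_pos (f := -β) (fun α hα => by simpa using hneg α hα)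
      (neg_ne_zero.2 h0) hp
    rw [LinearMap.neg_apply] at h1
    linarith

lemma nonneg_of_apply_pos (h : IsFundamentalCoweights R Δ αt ϖ) {p : V}
    (hp : ∀ α ∈ Δ, 0 < α p) {β : Module.Dual ℚ V} (hβ : β ∈ R.Φ) (hβp : 0 < β p) :
    ∀ α ∈ Δ, 0 ≤ β (ϖ α) := by
  refine (h.nonneg_or_nonpos β hβ).resolve_right fun hneg => ?_
  have h1 := h.apply_nonneg (f := -β) (fun α hα => by simpa using hneg α hα) fun α hα => (hp α hα).le
  rw [LinearMap.neg_apply] at h1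
  linarith

/-- The exchange condition. -/
lemma exists_list_mul_eq (h : IsFundamentalCoweights R Δ αt ϖ) {p : V}
    (hp : ∀ α ∈ Δ, 0 < α p) {α : Module.Dual ℚ V} (hα : α ∈ Δ) {s : V ≃ₗ[ℚ] V}
    (hs : ∀ v, s v = v - α v • R.coroot α) (l : List (V ≃ₗ[ℚ] V))
    (hl : ∀ t ∈ l, t ∈ reflSet R Δ) (hneg : α (l.prod p) < 0) :
    ∃ l' : List (V ≃ₗ[ℚ] V), (∀ t ∈ l', t ∈ reflSet R Δ) ∧ l'.length < l.length ∧
      l'.prod = s * l.prod := by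
  induction l using List.reverseRecOn with
  | nil => exact absurd hneg (hp α hα).not_gt
  | append_singleton l t ih =>
    have hl' : ∀ r ∈ l, r ∈ reflSet R Δ := fun r hr => hl r (by simp [hr])
    have htΔ : t ∈ reflSet R Δ := hl t (by simp)
    obtain ⟨β, hβ, ht⟩ := id htΔ
    have hlW := h.list_prod_mem_weyl hl'
    have hγ := comp_mem_of_mem_weyl hlW α (h.subset hα)
    rcases lt_or_ge (α (l.prod p)) 0 with hlt | hge
    · obtain ⟨l', h1, h2, h3⟩ := ih hl' hlt
      refine ⟨l' ++ [t], fun r hr => ?_, by simpa using h2, by simp [h3, mul_assoc]⟩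
      rcases List.mem_append.1 hr with hr | hr
      · exact h1 r hr
      · rwa [List.mem_singleton.1 hr]
    · set γ : Module.Dual ℚ V := α ∘ₗ (l.prod : V →ₗ[ℚ] V) with hγdef
      have hγp : 0 < γ p := lt_of_le_of_ne hge (h.apply_ne_zero hp hγ).symm
      have hrefl := R.dual_refl_mem β (h.subset hβ) γ hγ
      have hval : (γ - γ (R.coroot β) • β) p = α ((l ++ [t]).prod p) := by
        simp [hγdef, ht, mul_comm]
      have hγβ : γ = β := by
        refine h.eq_of_reflection_nonpos hβ hγ (h.nonneg_of_apply_pos hp hγ hγp) ?_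
        have h1 := h.nonneg_of_apply_pos hp (R.neg_mem hrefl)
          (by rw [LinearMap.neg_apply, hval]; linarith)
        intro δ hδ
        simpa using h1 δ hδ
      have hconj := reflection_mul_eq hlW (h.subset hα) hs ht hγβ
      refine ⟨l, hl', by simp, ?_⟩
      rw [List.prod_append, List.prod_singleton, ← mul_assoc, hconj, mul_assoc,
        mul_self_of_mem_reflSet (reflSet_mono h.subset htΔ), mul_one]

/-- The Weyl group acts freely on the open chambers. -/
lemma eq_one_of_apply_pos (h : IsFundamentalCoweights R Δ αt ϖ) {p : V}
    (hp : ∀ α ∈ Δ, 0 < α p) {u : V ≃ₗ[ℚ] V} (hu : u ∈ weyl R)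
    (hup : ∀ α ∈ Δ, 0 < α (u p)) : u = 1 := by
  obtain ⟨l, hl, rfl⟩ := h.exists_list hu
  obtain ⟨n, hn⟩ : ∃ n, l.length = n := ⟨_, rfl⟩
  induction n using Nat.strong_induction_on generalizing l with
  | _ n ih =>
    cases l with
    | nil => rfl
    | cons s l =>
      obtain ⟨α, hα, hs⟩ := hl s (by simp)
      have hl' : ∀ r ∈ l, r ∈ reflSet R Δ := fun r hr => hl r (by simp [hr])
      have hneg : α (l.prod p) < 0 := by
        have h1 := hup α hα
        simp only [List.prod_cons, LinearEquiv.mul_apply, hs, map_sub, map_smul, smul_eq_mul,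
          R.pairing_self α (h.subset hα)] at h1
        linarith
      obtain ⟨l', h1, h2, h3⟩ := h.exists_list_mul_eq hp hα hs l hl' hneg
      rw [← List.prod_cons] at h3
      rw [← h3] at hup hu ⊢
      exact ih _ (by simp at hn; omega) l' h1 hu hup rfl

lemma mfun_neg_highest (αt : Module.Dual ℚ V) : mfun αt (-αt) = -1 := if_pos rfl

lemma mfun_of_mem (hα₀ : -αt ∉ Δ) {α : Module.Dual ℚ V} (hα : α ∈ Δ) : mfun αt α = 0 :=
  if_neg (ne_of_mem_of_not_mem hα hα₀)

lemma mem_alcove_iff (hα₀ : -αt ∉ Δ) {q : V} :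
    q ∈ alcove Δ αt ↔ (∀ α ∈ Δ, 0 ≤ α q) ∧ αt q ≤ 1 := by
  simp only [alcove, extBase, Set.mem_ofPred_eq, Set.forall_mem_insert, mfun_neg_highest, Finset.mem_coe,
    LinearMap.neg_apply, neg_le_neg_iff]
  rw [and_comm]
  exact and_congr_left' (forall₂_congr fun α hα => by rw [mfun_of_mem hα₀ hα])

lemma extBase_subset (h : IsFundamentalCoweights R Δ αt ϖ) : extBase Δ αt ⊆ R.Φ :=
  Set.insert_subset (R.neg_mem h.highest_mem) h.subset

lemma mfun_int (αt α : Module.Dual ℚ V) : ∃ n : ℤ, (n : ℚ) = mfun αt α := by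
  unfold mfun
  split_ifs
  · exact ⟨-1, by norm_num⟩
  · exact ⟨0, by norm_num⟩

lemma exists_strip (h : IsFundamentalCoweights R Δ αt ϖ) (hα₀ : -αt ∉ Δ)
    {γ : Module.Dual ℚ V} (hγ : γ ∈ R.Φ) :
    ∃ k : ℤ, (∀ q ∈ alcove Δ αt, (k : ℚ) ≤ γ q ∧ γ q ≤ k + 1) ∧
      ∀ p, (∀ α ∈ Δ, 0 < α p) → αt p < 1 → (k : ℚ) < γ p ∧ γ p < k + 1 := by
  have h0 := R.root_ne_zero hγ
  rcases h.nonneg_or_nonpos γ hγ with hpos | hneg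
  · refine ⟨0, fun q hq => ?_, fun p hp ht => ?_⟩
    · obtain ⟨h1, h2⟩ := (mem_alcove_iff hα₀).1 hq
      have h3 := h.apply_nonneg hpos h1
      have h4 := h.apply_le_highest hγ h1
      exact ⟨by simpa using h3, by push_cast; linarith⟩
    · have h3 := h.apply_pos hpos h0 hp
      have h4 := h.apply_le_highest hγ fun α hα => (hp α hα).le
      exact ⟨by simpa using h3, by push_cast; linarith⟩
  · have hneg' : ∀ α ∈ Δ, 0 ≤ (-γ) (ϖ α) := fun α hα => by simpa using hneg α hα
    refine ⟨-1, fun q hq => ?_, fun p hp ht => ?_⟩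
    · obtain ⟨h1, h2⟩ := (mem_alcove_iff hα₀).1 hq
      have h3 := h.apply_nonneg hneg' h1
      have h4 := h.apply_le_highest (R.neg_mem hγ) h1
      rw [LinearMap.neg_apply] at h3 h4
      push_cast
      constructor <;> linarith
    · have h3 := h.apply_pos hneg' (neg_ne_zero.2 h0) hp
      have h4 := h.apply_le_highest (R.neg_mem hγ) fun α hα => (hp α hα).le
      rw [LinearMap.neg_apply] at h3 h4
      push_cast
      constructor <;> linarith

lemma abs_apply_le_one (h : IsFundamentalCoweights R Δ αt ϖ) (hα₀ : -αt ∉ Δ)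
    {γ : Module.Dual ℚ V} (hγ : γ ∈ R.Φ) {q : V} (hq : q ∈ alcove Δ αt) : |γ q| ≤ 1 := by
  obtain ⟨h1, h2⟩ := (mem_alcove_iff hα₀).1 hq
  have h3 := h.apply_le_highest hγ h1
  have h4 := h.apply_le_highest (R.neg_mem hγ) h1
  rw [LinearMap.neg_apply] at h4
  exact abs_le.2 ⟨by linarith, by linarith⟩

lemma apply_ne_int (h : IsFundamentalCoweights R Δ αt ϖ) (hα₀ : -αt ∉ Δ)
    {γ : Module.Dual ℚ V} (hγ : γ ∈ R.Φ) {p : V} (hp : ∀ α ∈ Δ, 0 < α p) (ht : αt p < 1)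
    (n : ℤ) : γ p ≠ n := by
  obtain ⟨k, -, hk⟩ := h.exists_strip hα₀ hγ
  obtain ⟨h1, h2⟩ := hk p hp ht
  intro e
  rw [e] at h1 h2
  norm_cast at h1 h2
  omega

lemma highest_apply_pos (h : IsFundamentalCoweights R Δ αt ϖ) {p : V}
    (hp : ∀ α ∈ Δ, 0 < α p) : 0 < αt p := by
  refine h.apply_pos (fun α hα => ?_) (R.root_ne_zero h.highest_mem) hp
  exact zero_le_one.trans (h.apply_self α hα ▸ h.le_highest α (h.subset hα) α hα)

lemma exists_interior (h : IsFundamentalCoweights R Δ αt ϖ) :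
    ∃ p : V, ∃ c : ℚ, 0 < c ∧ (∀ α ∈ Δ, α p = c) ∧ αt p < 1 := by
  set ρ := ∑ α ∈ Δ, ϖ α with hρ
  have h1 : ∀ α ∈ Δ, α ρ = 1 := fun α hα => by
    rw [hρ, map_sum, Finset.sum_eq_single_of_mem α hα fun β hβ hne =>
      h.apply_of_ne α hα β hβ hne.symm, h.apply_self α hα]
  have h2 : 0 < αt ρ := h.highest_apply_pos fun α hα => by rw [h1 α hα]; exact one_pos
  refine ⟨(αt ρ + 1)⁻¹ • ρ, (αt ρ + 1)⁻¹, by positivity, fun α hα => by simp [h1 α hα], ?_⟩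
  rw [map_smul, smul_eq_mul, inv_mul_lt_one₀ (by positivity)]
  linarith

/-- Each wall of the alcove has a point at which no other affine root that is nonnegative on the
alcove vanishes. -/
lemma exists_wall_point (h : IsFundamentalCoweights R Δ αt ϖ) (hα₀ : -αt ∉ Δ)
    {α : Module.Dual ℚ V} (hα : α ∈ extBase Δ αt) :
    ∃ q ∈ alcove Δ αt, α q = mfun αt α ∧ ∀ δ ∈ R.Φ, ∀ M : ℤ,
      (∀ r ∈ alcove Δ αt, (M : ℚ) ≤ δ r) → δ q = M → δ = α := by
  obtain ⟨p, c, hc, hpc, htp⟩ := h.exists_interior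
  have hp : ∀ β ∈ Δ, 0 < β p := fun β hβ => by rw [hpc β hβ]; exact hc
  have hpC : p ∈ alcove Δ αt := (mem_alcove_iff hα₀).2 ⟨fun β hβ => (hp β hβ).le, htp.le⟩
  have htpos := h.highest_apply_pos hp
  rcases Set.mem_insert_iff.1 hα with rfl | hαΔ
  · set q := (αt p)⁻¹ • p with hqdef
    have hq : ∀ β ∈ Δ, 0 < β q := fun β hβ => by
      rw [hqdef, map_smul, smul_eq_mul]
      exact mul_pos (inv_pos.2 htpos) (hp β hβ)
    have hqt : αt q = 1 := by
      rw [hqdef, map_smul, smul_eq_mul, inv_mul_cancel₀ htpos.ne']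
    have key : ∀ δ ∈ R.Φ, (∀ β ∈ Δ, 0 ≤ δ (ϖ β)) → ∀ M : ℤ, δ q = M → δ = αt := by
      intro δ hδ hpos M hM
      have h1 := h.apply_pos hpos (R.root_ne_zero hδ) hq
      have h2 := h.apply_le_highest hδ fun β hβ => (hq β hβ).le
      rw [hqt] at h2
      have hM1 : M = 1 := by
        rw [hM] at h1 h2
        norm_cast at h1 h2
        omega
      by_contra hne
      have h3 := h.apply_pos (f := αt - δ)
        (fun β hβ => by simpa using h.le_highest δ hδ β hβ) (sub_ne_zero.2 (Ne.symm hne)) hq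
      rw [LinearMap.sub_apply, hqt, hM, hM1] at h3
      simp at h3
    refine ⟨q, (mem_alcove_iff hα₀).2 ⟨fun β hβ => (hq β hβ).le, hqt.le⟩, ?_, ?_⟩
    · rw [LinearMap.neg_apply, hqt, mfun_neg_highest]
    · intro δ hδ M hM hδq
      rcases h.nonneg_or_nonpos δ hδ with hpos | hneg
      · have h1 := key δ hδ hpos M hδq
        subst h1
        have h2 := hM p hpC
        rw [← hδq, hqt] at h2
        linarith
      · have h1 := key (-δ) (R.neg_mem hδ) (fun β hβ => by simpa using hneg β hβ) (-M)
          (by simp [hδq])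
        rw [← h1, neg_neg]
  · have hαΔ : α ∈ Δ := hαΔ
    set q := p - c • ϖ α with hqdef
    have hqα : α q = 0 := by simp [hqdef, hpc α hαΔ, h.apply_self α hαΔ]
    have hqne : ∀ β ∈ Δ, β ≠ α → 0 < β q := fun β hβ hne => by
      simpa [hqdef, h.apply_of_ne β hβ α hαΔ hne] using hp β hβ
    have hq : ∀ β ∈ Δ, 0 ≤ β q := fun β hβ => by
      by_cases hne : β = α
      · rw [hne, hqα]
      · exact (hqne β hβ hne).le
    have hqt : αt q < 1 := by
      have h1 : 0 ≤ αt (ϖ α) :=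
        zero_le_one.trans (h.apply_self α hαΔ ▸ h.le_highest α (h.subset hαΔ) α hαΔ)
      have h2 := mul_nonneg hc.le h1
      rw [hqdef, map_sub, map_smul, smul_eq_mul]
      linarith
    have key : ∀ δ ∈ R.Φ, (∀ β ∈ Δ, 0 ≤ δ (ϖ β)) → ∀ M : ℤ, δ q = M → δ = α := by
      intro δ hδ hpos M hM
      have h1 := h.apply_nonneg hpos hq
      have h2 := (h.apply_le_highest hδ hq).trans_lt hqt
      have hM0 : M = 0 := by
        rw [hM] at h1 h2
        norm_cast at h1 h2
        omega
      rw [hM0, Int.cast_zero, h.apply_eq_sum, Finset.sum_eq_zero_iff_of_nonneg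
        fun β hβ => mul_nonneg (hpos β hβ) (hq β hβ)] at hM
      exact h.eq_of_forall_ne hαΔ hδ hpos fun β hβ hne =>
        (mul_eq_zero.1 (hM β hβ)).resolve_right (hqne β hβ hne).ne'
    refine ⟨q, (mem_alcove_iff hα₀).2 ⟨hq, hqt.le⟩, ?_, ?_⟩
    · rw [hqα, mfun_of_mem hα₀ hαΔ]
    · intro δ hδ M hM hδq
      rcases h.nonneg_or_nonpos δ hδ with hpos | hneg
      · exact key δ hδ hpos M hδq
      · have h1 := key (-δ) (R.neg_mem hδ) (fun β hβ => by simpa using hneg β hβ) (-M)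
          (by simp [hδq])
        have h2 := hM p hpC
        rw [← h1, LinearMap.neg_apply, hδq, neg_eq_zero] at hqα
        have h3 := hp α hαΔ
        rw [← h1, LinearMap.neg_apply] at h3
        linarith

/-- An affine transformation in the extended affine Weyl group that preserves the alcove permutes
its walls. -/
lemma extBase_subset_image (h : IsFundamentalCoweights R Δ αt ϖ) (hα₀ : -αt ∉ Δ)
    {z : V ≃ₗ[ℚ] V} (hz : z ∈ weyl R) {v : V} (hv : v ∈ coweightSet R)
    (hinv : ∀ q ∈ alcove Δ αt, z⁻¹ (q - v) ∈ alcove Δ αt) :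
    extBase Δ αt ⊆ dact z '' extBase Δ αt := by
  intro α hα
  have hαΦ := h.extBase_subset hα
  obtain ⟨q, hqC, hqα, hq⟩ := h.exists_wall_point hα₀ hα
  set q' := z⁻¹ (q - v) with hq'
  have hq'C : q' ∈ alcove Δ αt := hinv q hqC
  have hzq' : z q' = q - v := z.apply_symm_apply _
  obtain ⟨β, hβ, hβq⟩ : ∃ β ∈ extBase Δ αt, β q' = mfun αt β := by
    by_contra! hne
    have hpos : ∀ β ∈ Δ, 0 < β q' := fun β hβ => by
      refine lt_of_le_of_ne (((mem_alcove_iff hα₀).1 hq'C).1 β hβ) (Ne.symm ?_)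
      have h1 := hne β (Set.mem_insert_of_mem _ hβ)
      rwa [mfun_of_mem hα₀ hβ] at h1
    have ht : αt q' < 1 := by
      refine lt_of_le_of_ne ((mem_alcove_iff hα₀).1 hq'C).2 fun e => ?_
      refine hne _ (Set.mem_insert _ _) ?_
      rw [LinearMap.neg_apply, e, mfun_neg_highest]
    obtain ⟨m, hm⟩ := mfun_int αt α
    obtain ⟨n, hn⟩ := hv α hαΦ
    refine h.apply_ne_int hα₀ (comp_mem_of_mem_weyl hz α hαΦ) hpos ht (m - n) ?_
    simp [hzq', hqα, hm, hn]
  refine ⟨β, hβ, ?_⟩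
  have hδ : dact z β ∈ R.Φ := comp_mem_of_mem_weyl (inv_mem hz) β (h.extBase_subset hβ)
  obtain ⟨m, hm⟩ := mfun_int αt β
  obtain ⟨n, hn⟩ := hv _ hδ
  have hval : ∀ r, dact z β r = β (z⁻¹ (r - v)) + n := fun r => by
    rw [map_sub, map_sub, hn]
    exact (sub_add_cancel (β (z⁻¹ r)) (β (z⁻¹ v))).symm
  refine hq _ hδ (m + n) (fun r hr => ?_) ?_
  · rw [hval, Int.cast_add, hm]
    exact add_le_add_left (hinv r hr β hβ) _
  · rw [hval, ← hq', hβq, Int.cast_add, hm]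

/-- An affine transformation in the extended affine Weyl group that sends `x` to `y` and the
alcove near `x` to the alcove near `y` maps the alcove to itself. -/
lemma mapsTo_alcove (h : IsFundamentalCoweights R Δ αt ϖ) (hα₀ : -αt ∉ Δ) {p x y : V}
    (hp : ∀ α ∈ Δ, 0 < α p) (ht : αt p < 1) (hx : x ∈ alcove Δ αt) (hy : y ∈ alcove Δ αt)
    {z : V ≃ₗ[ℚ] V} (hz : z ∈ weyl R) (hv : y - z x ∈ coweightSet R)
    (hloc : ∀ β ∈ PhiOf R y, 0 < β (p - y) → 0 ≤ β (z (p - x))) :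
    ∀ q ∈ alcove Δ αt, z q + (y - z x) ∈ alcove Δ αt := by
  intro q hq α hα
  by_contra! hlt
  have hαΦ := h.extBase_subset hα
  have hγ := comp_mem_of_mem_weyl hz α hαΦ
  obtain ⟨k, hk, hk'⟩ := h.exists_strip hα₀ hγ
  obtain ⟨m, hm⟩ := mfun_int αt α
  obtain ⟨n, hn⟩ := hv α hαΦ
  have h1 := (hk q hq).1
  have h2 := (hk x hx).2
  have h3 := (hk' p hp ht).2
  have h4 := hy α hα
  have hn' : α y = α (z x) + n := by rw [hn, map_sub]; ring
  simp only [LinearMap.comp_apply, LinearEquiv.coe_coe] at h1 h2 h3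
  rw [map_add, ← hn, ← hm] at hlt
  rw [← hm, hn'] at h4
  have hkm : k < m - n := by exact_mod_cast (by linarith : (k : ℚ) < m - n)
  have hkm' : m - n ≤ k + 1 := by exact_mod_cast (by linarith : (m : ℚ) - n ≤ k + 1)
  have hmk : (m : ℚ) = n + k + 1 := by exact_mod_cast (by omega : m = n + k + 1)
  have hyα : α y = m := by linarith
  have hpα : 0 < α (p - y) := by
    rw [map_sub, hyα, hm, sub_pos]
    refine lt_of_le_of_ne ?_ fun e => ?_
    · exact (mem_alcove_iff hα₀).2 ⟨fun β hβ => (hp β hβ).le, ht.le⟩ α hα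
    · exact h.apply_ne_int hα₀ hαΦ hp ht m (by rw [← e, hm])
  have h5 := hloc α ⟨hαΦ, m, hyα.symm⟩ hpα
  rw [map_sub, map_sub] at h5
  linarith

end IsFundamentalCoweights

/-- Some element `u` of `W°(x)` moves `a` to the chamber of `b` with respect to `Φ(x)`. -/
lemma exists_mem_Wcirc_forall_nonneg (R : RootSystemData V) (x a b : V) :
    ∃ u ∈ Wcirc R x, ∀ γ ∈ PhiOf R x, 0 < γ b → 0 ≤ γ (u a) := by
  have hfin : (Wcirc R x : Set (V ≃ₗ[ℚ] V)).Finite :=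
    finite_weyl.subset (weylOf_mono fun _ h => h.1)
  obtain ⟨u, hu, hmax⟩ := Set.exists_max_image _ (fun u : V ≃ₗ[ℚ] V => rootForm R (u a) b) hfin
    ⟨1, one_mem _⟩
  refine ⟨u, hu, fun γ hγ hpos => ?_⟩
  by_contra! hneg
  obtain ⟨s, hs⟩ := exists_reflection hγ.1
  have h1 := hmax (s * u) (mul_mem (Subgroup.subset_closure ⟨γ, hγ, hs⟩) hu)
  rw [LinearEquiv.mul_apply, hs, rootForm_sub_smul] at h1
  linarith [mul_neg_of_neg_of_pos hneg (rootForm_coroot_pos hγ.1 hpos)]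

/-- The translation part of the `n`-th power of an affine transformation of the extended affine
Weyl group. -/
lemma exists_pow_translation {R : RootSystemData V} {S : Set V} {z : V ≃ₗ[ℚ] V}
    (hz : z ∈ weyl R) {v : V} (hv : v ∈ coweightSet R) (hS : ∀ q ∈ S, z q + v ∈ S) (n : ℕ) :
    ∃ t : V, t - (n : ℚ) • v ∈ corootLattice R ∧ ∀ q ∈ S, (z ^ n) q + t ∈ S := by
  induction n with
  | zero => exact ⟨0, by simp, by simp⟩
  | succ n ih =>
    obtain ⟨t, ht, htS⟩ := ih
    refine ⟨z t + v, ?_, fun q hq => ?_⟩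
    · have h1 := map_mem_corootLattice hz ht
      have h2 := map_sub_self_mem_corootLattice hz (nsmul_mem_coweightSet hv n)
      convert add_mem h1 h2 using 1
      rw [map_sub, Nat.cast_succ, ← Nat.cast_smul_eq_nsmul ℚ]
      module
    · have h1 := hS _ (htS q hq)
      rwa [map_add, add_assoc, ← LinearEquiv.mul_apply, ← pow_succ'] at h1

/-- Let λ, μ ∈ C and w ∈ W with μ − w(λ) ∈ L. Then w = z·w° with
z ∈ 𝒜_L and w° ∈ W°(λ); moreover z^d = 1 for every positive integer d with
d·λ ∈ Q∨ and d·μ ∈ Q∨. -/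
theorem weyl_decomposition_on_alcove
    {V : Type*} [AddCommGroup V] [Module ℚ V] [FiniteDimensional ℚ V]
    (R : RootSystemData V)
    (Δ : Finset (Module.Dual ℚ V))
    (hΔΦ : (Δ : Set (Module.Dual ℚ V)) ⊆ R.Φ)
    (hΔind : LinearIndependent ℚ
      (fun x : (Δ : Set (Module.Dual ℚ V)) => (x : Module.Dual ℚ V)))
    (hΔbase : ∀ α ∈ R.Φ, ∃ c : Module.Dual ℚ V →₀ ℤ,
        (c.support : Set (Module.Dual ℚ V)) ⊆ (Δ : Set (Module.Dual ℚ V)) ∧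
        α = c.sum (fun β k => (k : ℚ) • β) ∧
        ((∀ β, 0 ≤ c β) ∨ (∀ β, c β ≤ 0)))
    (αt : Module.Dual ℚ V) (hαtΦ : αt ∈ R.Φ)
    (hhigh : ∀ γ ∈ R.Φ, ∃ c : Module.Dual ℚ V →₀ ℚ,
        (c.support : Set (Module.Dual ℚ V)) ⊆ (Δ : Set (Module.Dual ℚ V)) ∧
        αt - γ = c.sum (fun β k => k • β) ∧ (∀ β, 0 ≤ c β))
    (hα₀ : -αt ∉ (Δ : Set (Module.Dual ℚ V)))
    (L : AddSubgroup V)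
    (hQL : (corootLattice R : Set V) ⊆ (L : Set V))
    (hLP : (L : Set V) ⊆ coweightSet R)
    (x y : V) (hx : x ∈ alcove Δ αt) (hy : y ∈ alcove Δ αt)
    (w : V ≃ₗ[ℚ] V) (hw : w ∈ weyl R) (hdiff : y - w x ∈ L) :
    ∃ z w₀ : V ≃ₗ[ℚ] V, z ∈ AutTildeL R Δ αt L ∧ w₀ ∈ Wcirc R x ∧ w = z * w₀ ∧
      ∀ d : ℕ, 0 < d → (d : ℚ) • x ∈ corootLattice R → (d : ℚ) • y ∈ corootLattice R →
        z ^ d = 1 := by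
  obtain ⟨ϖ, h⟩ := exists_fundamentalCoweights R Δ hΔΦ hΔind hΔbase αt hαtΦ hhigh
  replace hα₀ : -αt ∉ Δ := hα₀
  obtain ⟨p, c, hc, hpc, ht⟩ := h.exists_interior
  have hp : ∀ α ∈ Δ, 0 < α p := fun α hα => (hpc α hα).symm ▸ hc
  obtain ⟨u, hu, hchamber⟩ := exists_mem_Wcirc_forall_nonneg R x (p - x) (w⁻¹ (p - y))
  have huW : u ∈ weyl R := weylOf_mono (fun _ h => h.1) hu
  set z := w * u with hzdef
  have hz : z ∈ weyl R := mul_mem hw huW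
  set v := y - z x with hvdef
  have hvL : v ∈ L := by
    have h1 := hQL (map_mem_corootLattice hw (sub_mem_corootLattice_of_mem_Wcirc hu))
    convert sub_mem hdiff h1 using 1
    simp [hvdef, hzdef]
  have hv := hLP hvL
  have hloc : ∀ β ∈ PhiOf R y, 0 < β (p - y) → 0 ≤ β (z (p - x)) := by
    rintro β ⟨hβ, k, hk⟩ hpos
    obtain ⟨n, hn⟩ := hLP hdiff β hβ
    refine hchamber (β ∘ₗ (w : V →ₗ[ℚ] V)) ⟨comp_mem_of_mem_weyl hw β hβ, k - n, ?_⟩ ?_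
    · rw [Int.cast_sub, hk, hn, map_sub]
      exact sub_sub_cancel _ _
    · exact lt_of_lt_of_eq hpos (congrArg β (w.apply_symm_apply _)).symm
  have hzx : z⁻¹ y = x + z⁻¹ v := by
    rw [hvdef, map_sub, show z⁻¹ (z x) = x from z.symm_apply_apply x]
    abel
  have hvinv : x - z⁻¹ y = -z⁻¹ v := by rw [hzx]; abel
  have hloc' : ∀ β ∈ PhiOf R x, 0 < β (p - x) → 0 ≤ β (z⁻¹ (p - y)) := by
    rintro β ⟨hβ, k, hk⟩ hpos
    by_contra! hneg
    have hβ' := comp_mem_of_mem_weyl (inv_mem hz) β hβ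
    obtain ⟨n, hn⟩ := hv _ hβ'
    have hn' : (n : ℚ) = β (z⁻¹ v) := hn
    have h1 := hloc (-(β ∘ₗ ((z⁻¹ : V ≃ₗ[ℚ] V) : V →ₗ[ℚ] V))) ⟨R.neg_mem hβ', -(k + n), ?_⟩ ?_
    · have h2 : 0 ≤ -β (z⁻¹ (z (p - x))) := h1
      rw [show z⁻¹ (z (p - x)) = p - x from z.symm_apply_apply _] at h2
      linarith
    · change _ = -β (z⁻¹ y)
      rw [hzx, map_add, ← hk, ← hn', Int.cast_neg, Int.cast_add]
    · exact neg_pos.2 hneg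
  have hmaps := h.mapsTo_alcove hα₀ hp ht hx hy hz hv hloc
  have hmaps' : ∀ q ∈ alcove Δ αt, z⁻¹ (q - v) ∈ alcove Δ αt := by
    intro q hq
    have h1 := h.mapsTo_alcove hα₀ hp ht hy hx (inv_mem hz)
      (hvinv ▸ neg_mem_coweightSet (map_mem_coweightSet (inv_mem hz) hv)) hloc' q hq
    rwa [hvinv, ← sub_eq_add_neg, ← map_sub] at h1
  refine ⟨z, u⁻¹, ⟨⟨hz, Set.Subset.antisymm ?_ (h.extBase_subset_image hα₀ hz hv hmaps')⟩, v, hvL,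
    Set.Subset.antisymm ?_ fun q hq => ⟨_, hmaps' q hq, ?_⟩⟩, inv_mem hu, by simp [hzdef],
    fun d _ hdx hdy => ?_⟩
  · rintro _ ⟨α, hα, rfl⟩
    obtain ⟨β, hβ, rfl⟩ := h.extBase_subset_image hα₀ (inv_mem hz)
      (neg_mem_coweightSet (map_mem_coweightSet (inv_mem hz) hv))
      (fun q hq => by simpa [z.apply_symm_apply v] using hmaps q hq) hα
    convert hβ using 1
    ext r
    exact congrArg β (z.apply_symm_apply r)
  · rintro _ ⟨q, hq, rfl⟩
    exact hmaps q hq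
  · exact (congrArg (· + v) (z.apply_symm_apply _)).trans (sub_add_cancel q v)
  · obtain ⟨t, htv, htC⟩ := exists_pow_translation hz hv hmaps d
    have htQ : t ∈ corootLattice R := by
      convert add_mem htv (sub_mem hdy (map_mem_corootLattice hz hdx)) using 1
      rw [hvdef, map_smul]
      module
    have ht0 : t = 0 := by
      refine eq_zero_of_mem_corootLattice_of_abs_le_one htQ fun α hα => ?_
      refine h.abs_apply_le_one hα₀ hα ?_
      simpa using htC 0 ((IsFundamentalCoweights.mem_alcove_iff hα₀).2 (by simp))
    have hzd : z ^ d ∈ weyl R := pow_mem hz d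
    refine h.eq_one_of_apply_pos hp hzd fun α hα => ?_
    have h1 := htC p ((IsFundamentalCoweights.mem_alcove_iff hα₀).2 ⟨fun β hβ => (hp β hβ).le, ht.le⟩)
    rw [ht0, add_zero] at h1
    exact lt_of_le_of_ne (((IsFundamentalCoweights.mem_alcove_iff hα₀).1 h1).1 α hα)
      (h.apply_ne_zero hp (comp_mem_of_mem_weyl hzd α (h.subset hα))).symm
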